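/- Let w₁, w₂ be nonzero complex numbers with w₁/w₂ ∉ ℝ, and let Γ be the additive subgroup of ℂ generated by w₁ and w₂. Then the torus T = ℂ/Γ, with the quotient topology, is not simply connected. -/

import Mathlib

/-- If the quotient of a path-connected topological abelian group by a discrete subgroup is simply
connected, then the subgroup is trivial. -/
theorem AddSubgroup.eq_bot_of_simplyConnectedSpace_quotient {E : Type*} [AddCommGroup E]
    [TopologicalSpace E] [IsTopologicalAddGroup E] [PathConnectedSpace E] (S : AddSubgroup E)
    (hS : IsDiscrete (S : Set E)) [SimplyConnectedSpace (E ⧸ S)] : S = ⊥ := by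
  have hsurj := (S.isAddQuotientCoveringMap_of_comm hS).fundamentalGroupToMulOpposite_surjective
    (x := ((0 : E) : E ⧸ S)) ⟨0, rfl⟩
  have : Subsingleton (Multiplicative S)ᵐᵒᵖ := hsurj.subsingleton
  have : Subsingleton S :=
    (Multiplicative.ofAdd.trans MulOpposite.opEquiv : S ≃ (Multiplicative S)ᵐᵒᵖ).subsingleton
  exact S.eq_bot_of_subsingleton

theorem Complex.linearIndependent_pair_of_div_notMem_range {w₁ w₂ : ℂ} (hw₂ : w₂ ≠ 0)
    (hratio : w₁ / w₂ ∉ Set.range ((↑) : ℝ → ℂ)) : LinearIndependent ℝ ![w₁, w₂] := by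
  rw [LinearIndependent.pair_symm_iff, LinearIndependent.pair_iff' hw₂]
  rintro a rfl
  exact hratio ⟨a, by simp [hw₂]⟩

theorem Complex.isDiscrete_closure_pair {w₁ w₂ : ℂ} (h : LinearIndependent ℝ ![w₁, w₂]) :
    IsDiscrete (AddSubgroup.closure {w₁, w₂} : Set ℂ) := by
  rw [← Submodule.span_int_eq_addSubgroupClosure]
  exact ⟨inferInstanceAs (DiscreteTopology (PeriodPair.mk w₁ w₂ h).lattice)⟩

theorem torus_not_simply_connected (w₁ w₂ : ℂ) (hw₁ : w₁ ≠ 0) (hw₂ : w₂ ≠ 0)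
    (hratio : w₁ / w₂ ∉ Set.range ((↑) : ℝ → ℂ))
    (Γ : AddSubgroup ℂ) (hΓ : Γ = AddSubgroup.closure {w₁, w₂}) :
    ¬ SimplyConnectedSpace (ℂ ⧸ Γ) := by
  intro _
  have hdisc : IsDiscrete (Γ : Set ℂ) := hΓ ▸ Complex.isDiscrete_closure_pair
    (Complex.linearIndependent_pair_of_div_notMem_range hw₂ hratio)
  have hmem : w₁ ∈ Γ := hΓ ▸ AddSubgroup.subset_closure (by simp)
  rw [Γ.eq_bot_of_simplyConnectedSpace_quotient hdisc] at hmem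
  exact hw₁ (AddSubgroup.mem_bot.mp hmem)
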